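/- Let M₁ and M₂ be real 2×2 matrices of determinant 1 and let M₃ = M₁M₂, with entries M_j = (a_j b_j; c_j d_j) for j = 1, 2, 3. Then there exists σ ∈ {1, −1} such that for every Schwartz function f : ℝ → ℂ and every x ∈ ℝ, 𝓜(M₁)(𝓜(M₂)f)(x) = σ·𝓜(M₃)f(x). Moreover, for every τ ∈ ℂ with Im τ > 0 such that none of a₂ + b₂τ, a₃ + b₃τ and (a₃ + b₃τ)/(a₂ + b₂τ) is a nonpositive real number, σ = (a₂ + b₂τ)^(−1/2)·((a₃ + b₃τ)/(a₂ + b₂τ))^(−1/2)·(a₃ + b₃τ)^(1/2), where each complex square root is taken with positive real part. -/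

import Mathlib

open MeasureTheory

/-- The metaplectic operator `𝓜(M)` associated with a real matrix `M = (a b; c d)` with
`ad - bc = 1`, acting on functions `f : ℝ → ℂ`.  Square roots with positive real part are
given by the principal complex power. -/
noncomputable def metaplectic (a b c d : ℝ) (f : ℝ → ℂ) (x : ℝ) : ℂ :=
  if b ≠ 0 then
    (Complex.I * (b : ℂ)) ^ (-(1/2) : ℂ) *
      ∫ y : ℝ, Complex.exp ((Real.pi : ℂ) * Complex.I / (b : ℂ) *
        ((d * x ^ 2 - 2 * x * y + a * y ^ 2 : ℝ) : ℂ)) * f y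
  else if 0 < a then
    (a : ℂ) ^ (-(1/2) : ℂ) * Complex.exp ((Real.pi : ℂ) * Complex.I * ((c / a : ℝ) : ℂ)
      * ((x : ℂ)) ^ 2) * f (x / a)
  else
    -Complex.I * ((-a : ℝ) : ℂ) ^ (-(1/2) : ℂ) *
      Complex.exp ((Real.pi : ℂ) * Complex.I * ((c / a : ℝ) : ℂ) * ((x : ℂ)) ^ 2) * f (x / a)

/-- The pairing `⟨S_{(q/2,p/2)} 𝓜(M) Ш₁, f⟩ = ∑_{n ∈ ℤ} (𝓜(M') g)(n)` where
`M' = (d b; c a)` and `g(x) = exp(πiqp/4 + πipx) f(x + q/2)`. -/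
noncomputable def shiftMetaPair (a b c d q p : ℝ) (f : ℝ → ℂ) : ℂ :=
  ∑' n : ℤ, metaplectic d b c a
    (fun x => Complex.exp ((Real.pi : ℂ) * Complex.I * (q : ℂ) * (p : ℂ) / 4
        + (Real.pi : ℂ) * Complex.I * (p : ℂ) * (x : ℂ)) * f (x + q / 2)) (n : ℝ)

open Filter Topology FourierTransform

lemma iteratedDeriv_cexp_mul_I (n : ℕ) :
    iteratedDeriv n (fun t : ℝ => Complex.exp (t * Complex.I)) =
      fun t : ℝ => Complex.I ^ n * Complex.exp (t * Complex.I) := by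
  induction n with
  | zero => simp
  | succ n ih =>
    rw [iteratedDeriv_succ, ih]
    funext t
    have h : HasDerivAt (fun t : ℝ => Complex.I ^ n * Complex.exp (t * Complex.I))
        (Complex.I ^ n * (Complex.exp (t * Complex.I) * (1 * Complex.I))) t :=
      ((((hasDerivAt_id t).ofReal_comp).mul_const Complex.I).cexp).const_mul _
    rw [h.deriv]
    ring

lemma hasTemperateGrowth_cexp_mul_I :
    Function.HasTemperateGrowth (fun t : ℝ => Complex.exp (t * Complex.I)) := by
  refine ⟨?_, fun n => ⟨0, 1, fun t => ?_⟩⟩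
  · exact (Complex.ofRealCLM.contDiff.mul contDiff_const).cexp
  · rw [norm_iteratedFDeriv_eq_norm_iteratedDeriv, iteratedDeriv_cexp_mul_I]
    simp [Complex.norm_exp_ofReal_mul_I]

/-- The quadratic phase `exp(πisx²)`. -/
noncomputable def chirp (s x : ℝ) : ℂ := Complex.exp ((Real.pi * s * x ^ 2 : ℝ) * Complex.I)

lemma norm_chirp (s x : ℝ) : ‖chirp s x‖ = 1 := Complex.norm_exp_ofReal_mul_I _

lemma continuous_chirp (s : ℝ) : Continuous (chirp s) := by
  unfold chirp
  fun_prop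

lemma hasTemperateGrowth_chirp (s : ℝ) : Function.HasTemperateGrowth (chirp s) :=
  hasTemperateGrowth_cexp_mul_I.comp (f := fun x : ℝ => Real.pi * s * x ^ 2) (by fun_prop)

/-- Continuous integrable functions all of whose products with quadratic phases have an integrable
Fourier transform. -/
structure ChirpFourierIntegrable (f : ℝ → ℂ) : Prop where
  continuous : Continuous f
  integrable : Integrable f
  integrable_fourier : ∀ s, Integrable (𝓕 (fun x => chirp s x * f x))

lemma SchwartzMap.chirpFourierIntegrable (f : SchwartzMap ℝ ℂ) :
    ChirpFourierIntegrable f := by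
  refine ⟨f.continuous, f.integrable, fun s => ?_⟩
  have h := (𝓕 (SchwartzMap.smulLeftCLM ℂ (chirp s) f)).integrable (μ := volume)
  rwa [SchwartzMap.fourier_coe, SchwartzMap.smulLeftCLM_apply (hasTemperateGrowth_chirp s)] at h

lemma chirpFourierIntegrable_gaussian {τ : ℂ} (hτ : 0 < τ.im) :
    ChirpFourierIntegrable (fun x : ℝ => Complex.exp (Real.pi * Complex.I * τ * x ^ 2)) := by
  refine ⟨by fun_prop, ?_, fun s => ?_⟩
  · have hw : 0 < (-(Real.pi * Complex.I * τ)).re := by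
      simpa using mul_pos Real.pi_pos hτ
    simpa using integrable_cexp_quadratic hw 0 0
  · have hw : 0 < (-Complex.I * (s + τ)).re := by simpa using hτ
    have hne : -Complex.I * (s + τ) ≠ 0 := fun h => by simp [h] at hw
    have hw' : 0 < (Real.pi / (-Complex.I * (s + τ))).re := by
      rw [div_eq_mul_inv, Complex.re_ofReal_mul, Complex.inv_re]
      exact mul_pos Real.pi_pos (div_pos hw (Complex.normSq_pos.2 hne))
    have key := fourier_gaussian_pi hw
    have heq : (fun x : ℝ => chirp s x * Complex.exp (Real.pi * Complex.I * τ * x ^ 2)) =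
        fun x : ℝ => Complex.exp (-Real.pi * (-Complex.I * (s + τ)) * x ^ 2) := by
      funext x
      rw [chirp, ← Complex.exp_add]
      congr 1
      push_cast
      ring
    rw [heq, key]
    refine Integrable.const_mul ?_ _
    simpa [neg_div] using integrable_cexp_quadratic hw' 0 0

/-- The Fourier transform of a quadratic phase of nonzero curvature, in weak form. -/
lemma integral_fourier_mul_chirp {h : ℝ → ℂ} (hh : Integrable h) (hFh : Integrable (𝓕 h))
    {s : ℝ} (hs : s ≠ 0) (u : ℝ) :
    ∫ y : ℝ, 𝓕 h y * Complex.exp (Real.pi * Complex.I * s * y ^ 2 - 2 * Real.pi * Complex.I * u * y)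
      = 1 / (-Complex.I * s) ^ (1 / 2 : ℂ) *
        ∫ t : ℝ, h t * Complex.exp (-(Real.pi * Complex.I / s) * (t + u) ^ 2) := by
  have hL : Tendsto (fun ε : ℝ => ∫ y : ℝ, 𝓕 h y * Complex.exp
        (-Real.pi * (ε - Complex.I * s) * y ^ 2 + 2 * Real.pi * (-Complex.I * u) * y)) (𝓝[>] 0)
      (𝓝 (∫ y : ℝ, 𝓕 h y * Complex.exp
        (-Real.pi * ((0 : ℝ) - Complex.I * s) * y ^ 2 + 2 * Real.pi * (-Complex.I * u) * y))) := by
    refine tendsto_integral_filter_of_dominated_convergence (fun y => ‖𝓕 h y‖) ?_ ?_ hFh.norm ?_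
    · exact Eventually.of_forall fun ε => hFh.aestronglyMeasurable.mul
        (Continuous.aestronglyMeasurable (by fun_prop))
    · filter_upwards [self_mem_nhdsWithin] with ε hε
      refine Eventually.of_forall fun y => ?_
      rw [norm_mul, Complex.norm_exp]
      refine mul_le_of_le_one_right (norm_nonneg _) (Real.exp_le_one_iff.2 ?_)
      have : 0 ≤ Real.pi * ε * y ^ 2 := by
        have := Set.mem_Ioi.1 hε
        positivity
      simp [← Complex.ofReal_pow]
      linarith
    · refine Eventually.of_forall fun y => ?_
      refine Tendsto.mono_left ?_ nhdsWithin_le_nhds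
      exact Continuous.tendsto (by fun_prop) 0
  have hslit : (((0 : ℝ) - Complex.I * s : ℂ)) ∈ Complex.slitPlane := by
    rw [Complex.mem_slitPlane_iff]
    right
    simpa using hs
  have hR : Tendsto (fun ε : ℝ => 1 / (ε - Complex.I * s) ^ (1 / 2 : ℂ) *
        ∫ t : ℝ, h t * Complex.exp
          (-Real.pi / (ε - Complex.I * s) * (t + Complex.I * (-Complex.I * u)) ^ 2))
      (𝓝[>] 0)
      (𝓝 (1 / ((0 : ℝ) - Complex.I * s) ^ (1 / 2 : ℂ) *
        ∫ t : ℝ, h t * Complex.exp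
          (-Real.pi / ((0 : ℝ) - Complex.I * s) * (t + Complex.I * (-Complex.I * u)) ^ 2))) := by
    have hc : ContinuousAt (fun ε : ℝ => (ε - Complex.I * s : ℂ)) 0 := by fun_prop
    refine Tendsto.mul ?_ ?_
    · refine Tendsto.mono_left ?_ nhdsWithin_le_nhds
      have : ContinuousAt (fun ε : ℝ => 1 / (ε - Complex.I * s) ^ (1 / 2 : ℂ)) 0 := by
        refine continuousAt_const.div (hc.cpow continuousAt_const hslit) ?_
        rw [Ne, Complex.cpow_eq_zero_iff]
        exact fun h => Complex.slitPlane_ne_zero hslit h.1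
      exact this
    · refine tendsto_integral_filter_of_dominated_convergence (fun y => ‖h y‖) ?_ ?_ hh.norm ?_
      · exact Eventually.of_forall fun ε => hh.aestronglyMeasurable.mul
          (Continuous.aestronglyMeasurable (by fun_prop))
      · filter_upwards [self_mem_nhdsWithin] with ε hε
        refine Eventually.of_forall fun t => ?_
        rw [norm_mul, Complex.norm_exp]
        refine mul_le_of_le_one_right (norm_nonneg _) (Real.exp_le_one_iff.2 ?_)
        have hre : (t + Complex.I * (-Complex.I * u) : ℂ) = ((t + u : ℝ) : ℂ) := by
          push_cast
          linear_combination (-(u : ℂ)) * Complex.I_sq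
        rw [hre, ← Complex.ofReal_pow, Complex.re_mul_ofReal, div_eq_mul_inv, ← Complex.ofReal_neg,
          Complex.re_ofReal_mul, Complex.inv_re]
        have : (ε - Complex.I * s : ℂ).re = ε := by simp
        rw [this]
        have h1 : 0 ≤ ε / Complex.normSq (ε - Complex.I * s) :=
          div_nonneg (le_of_lt hε) (Complex.normSq_nonneg _)
        have h2 : 0 ≤ Real.pi * (ε / Complex.normSq (ε - Complex.I * s)) * (t + u) ^ 2 := by
          have := Real.pi_pos
          positivity
        linarith
      · refine Eventually.of_forall fun t => ?_
        refine Tendsto.mono_left ?_ nhdsWithin_le_nhds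
        have : ContinuousAt (fun ε : ℝ => h t * Complex.exp
            (-Real.pi / (ε - Complex.I * s) * (t + Complex.I * (-Complex.I * u)) ^ 2)) 0 :=
          continuousAt_const.mul (((continuousAt_const.div hc
            (Complex.slitPlane_ne_zero hslit)).mul continuousAt_const).cexp)
        exact this
  have hEq : ∀ᶠ ε : ℝ in 𝓝[>] 0, (∫ y : ℝ, 𝓕 h y * Complex.exp
        (-Real.pi * (ε - Complex.I * s) * y ^ 2 + 2 * Real.pi * (-Complex.I * u) * y)) =
      1 / (ε - Complex.I * s) ^ (1 / 2 : ℂ) *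
        ∫ t : ℝ, h t * Complex.exp
          (-Real.pi / (ε - Complex.I * s) * (t + Complex.I * (-Complex.I * u)) ^ 2) := by
    filter_upwards [self_mem_nhdsWithin] with ε hε
    have hre : 0 < (ε - Complex.I * s : ℂ).re := by simpa using hε
    have hpi : 0 < (Real.pi * (ε - Complex.I * s) : ℂ).re := by
      rw [Complex.re_ofReal_mul]
      exact mul_pos Real.pi_pos hre
    set G : ℝ → ℂ := fun y : ℝ => Complex.exp
        (-Real.pi * (ε - Complex.I * s) * y ^ 2 + 2 * Real.pi * (-Complex.I * u) * y) with hGdef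
    have hG : Integrable G := by
      simpa [hGdef] using integrable_cexp_quadratic hpi (2 * Real.pi * (-Complex.I * u)) 0
    have hFG := VectorFourier.integral_fourierIntegral_smul_eq_flip (L := innerₗ ℝ)
      Real.continuous_fourierChar continuous_inner hh hG
    rw [flip_innerₗ] at hFG
    change ∫ y : ℝ, 𝓕 h y * G y = ∫ t : ℝ, h t * 𝓕 G t at hFG
    change ∫ y : ℝ, 𝓕 h y * G y = _
    rw [hFG, hGdef, fourier_gaussian_pi' hre, ← integral_const_mul]
    refine integral_congr_ae (Eventually.of_forall fun t => ?_)
    simp only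
    ring
  have hlim := tendsto_nhds_unique (hL.congr' hEq) hR
  have hs' : (s : ℂ) ≠ 0 := by exact_mod_cast hs
  convert hlim using 2
  · funext y
    congr 2
    push_cast
    ring
  · congr 2
    push_cast
    ring
  · congr 1
    funext t
    congr 2
    push_cast
    have hI : (t + Complex.I * (-Complex.I * u) : ℂ) = t + u := by
      linear_combination (-(u : ℂ)) * Complex.I_sq
    rw [hI]
    have hd : -(Real.pi : ℂ) / (0 - Complex.I * s) = -(Real.pi * Complex.I / s) := by
      rw [div_eq_iff (by simp [hs'])]
      field_simp
      linear_combination (-(s : ℂ)) * Complex.I_sq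
    rw [hd]

/-- The scalar factor in the definition of `metaplectic`. -/
noncomputable def metaplecticFactor (a b : ℝ) : ℂ :=
  if b ≠ 0 then (Complex.I * (b : ℂ)) ^ (-(1/2) : ℂ)
  else if 0 < a then (a : ℂ) ^ (-(1/2) : ℂ)
  else -Complex.I * ((-a : ℝ) : ℂ) ^ (-(1/2) : ℂ)

lemma metaplecticFactor_ne_zero {a b c d : ℝ} (h : a * d - b * c = 1) :
    metaplecticFactor a b ≠ 0 := by
  unfold metaplecticFactor
  split_ifs with hb ha
  · simp [Complex.cpow_eq_zero_iff, hb]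
  · simp [Complex.cpow_eq_zero_iff, ha.ne']
  · have ha' : a ≠ 0 := by
      rintro rfl
      simp [not_not.1 hb] at h
    simp [Complex.cpow_eq_zero_iff, ha']

lemma metaplectic_of_ne_zero (a c d : ℝ) {b : ℝ} (hb : b ≠ 0) (f : ℝ → ℂ) (x : ℝ) :
    metaplectic a b c d f x = metaplecticFactor a b *
      ∫ y : ℝ, Complex.exp ((Real.pi : ℂ) * Complex.I / (b : ℂ) *
        ((d * x ^ 2 - 2 * x * y + a * y ^ 2 : ℝ) : ℂ)) * f y := by
  simp only [metaplectic, metaplecticFactor, if_pos hb]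

lemma metaplectic_of_eq_zero (a c d : ℝ) {b : ℝ} (hb : b = 0) (f : ℝ → ℂ) (x : ℝ) :
    metaplectic a b c d f x = metaplecticFactor a b *
      (Complex.exp ((Real.pi : ℂ) * Complex.I * ((c / a : ℝ) : ℂ) * ((x : ℂ)) ^ 2) *
        f (x / a)) := by
  simp only [metaplectic, metaplecticFactor, if_neg (not_not.2 hb)]
  split_ifs <;> ring

lemma metaplectic_eq_fourier (a c d : ℝ) {b : ℝ} (hb : b ≠ 0) (f : ℝ → ℂ) (x : ℝ) :
    metaplectic a b c d f x = metaplecticFactor a b *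
      (chirp (d / b) x * 𝓕 (fun y => chirp (a / b) y * f y) (x / b)) := by
  rw [metaplectic_of_ne_zero a c d hb, Real.fourier_real_eq_integral_exp_smul,
    ← integral_const_mul (chirp (d / b) x)]
  congr 2
  funext y
  rw [smul_eq_mul, ← mul_assoc, ← mul_assoc, chirp, chirp, ← Complex.exp_add, ← Complex.exp_add]
  congr 2
  have : (b : ℂ) ≠ 0 := by exact_mod_cast hb
  push_cast
  field_simp
  ring

lemma cpow_I_mul_mul {b : ℝ} (hb : b ≠ 0) {w : ℂ} (hw : 0 < w.re) (r : ℂ) :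
    (Complex.I * b) ^ r * w ^ r = (Complex.I * b * w) ^ r := by
  have hIb : Complex.I * (b : ℂ) ≠ 0 := by simp [hb]
  have hw0 : w ≠ 0 := fun h => by simp [h] at hw
  have hargw := abs_lt.1 (Complex.abs_arg_lt_pi_div_two_iff.2 (Or.inl hw))
  have hargb : |(Complex.I * (b : ℂ)).arg| ≤ Real.pi / 2 := by
    rw [Complex.abs_arg_le_pi_div_two_iff]
    simp
  rw [abs_le] at hargb
  rw [Complex.cpow_def_of_ne_zero hIb, Complex.cpow_def_of_ne_zero hw0,
    Complex.cpow_def_of_ne_zero (mul_ne_zero hIb hw0),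
    (Complex.log_mul_eq_add_log_iff hIb hw0).2 ⟨by linarith, by linarith⟩, ← Complex.exp_add]
  ring_nf

lemma add_mul_ne_zero_of_im_pos {a b c d : ℝ} (h : a * d - b * c = 1) {τ : ℂ} (hτ : 0 < τ.im) :
    (a : ℂ) + b * τ ≠ 0 := by
  intro h0
  have him := congrArg Complex.im h0
  have hre := congrArg Complex.re h0
  simp only [Complex.add_im, Complex.ofReal_im, Complex.im_ofReal_mul, Complex.zero_im, zero_add,
    mul_eq_zero, hτ.ne', or_false, Complex.add_re, Complex.ofReal_re, Complex.re_ofReal_mul,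
    Complex.zero_re] at him hre
  subst him
  simp at hre
  subst hre
  simp at h

lemma mobius_im_pos {a b c d : ℝ} (h : a * d - b * c = 1) {τ : ℂ} (hτ : 0 < τ.im) :
    0 < ((c + d * τ) / (a + b * τ) : ℂ).im := by
  have h0 := Complex.normSq_pos.2 (add_mul_ne_zero_of_im_pos h hτ)
  rw [Complex.div_im, ← sub_div]
  refine div_pos ?_ h0
  simp
  nlinarith

/-- The metaplectic operator acts on Gaussians through a Möbius transformation. -/
lemma metaplectic_gaussian {a b c d : ℝ} (h : a * d - b * c = 1) {τ : ℂ} (hτ : 0 < τ.im) (x : ℝ) :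
    metaplectic a b c d (fun y : ℝ => Complex.exp (Real.pi * Complex.I * τ * y ^ 2)) x =
      (a + b * τ) ^ (-(1/2) : ℂ) *
        Complex.exp (Real.pi * Complex.I * ((c + d * τ) / (a + b * τ)) * x ^ 2) := by
  have hz := add_mul_ne_zero_of_im_pos h hτ
  have hC : (a : ℂ) * d - b * c = 1 := by exact_mod_cast h
  by_cases hb : b = 0
  · subst hb
    simp only [Complex.ofReal_zero, zero_mul, sub_zero, add_zero] at hz hC ⊢
    have ha : a ≠ 0 := by exact_mod_cast hz
    have hfac : metaplecticFactor a 0 = (a : ℂ) ^ (-(1/2) : ℂ) := by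
      rw [metaplecticFactor, if_neg (by simp)]
      split_ifs with hpos
      · rfl
      · have hneg : a < 0 := lt_of_le_of_ne (not_lt.1 hpos) ha
        have hlog : Complex.log a = Complex.log ((-a : ℝ) : ℂ) + Real.pi * Complex.I := by
          rw [Complex.log, Complex.log, Complex.arg_ofReal_of_neg hneg,
            Complex.arg_ofReal_of_nonneg (by linarith)]
          simp
        have hexp : Complex.exp (Real.pi * Complex.I * (-(1/2))) = -Complex.I := by
          have harg : (Real.pi * Complex.I * (-(1/2)) : ℂ) = -Real.pi / 2 * Complex.I := by ring
          rw [harg, Complex.exp_neg_pi_div_two_mul_I]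
        rw [Complex.cpow_def_of_ne_zero hz, Complex.cpow_def_of_ne_zero (by simpa using ha),
          hlog, add_mul, Complex.exp_add, hexp, mul_comm]
    rw [metaplectic_of_eq_zero a c d rfl, hfac, ← Complex.exp_add]
    congr 2
    push_cast
    field_simp
    linear_combination (-(x : ℂ) ^ 2 * τ) * hC
  · have hbC : (b : ℂ) ≠ 0 := by exact_mod_cast hb
    have hw : 0 < ((a + b * τ) / (Complex.I * b)).re := by
      have : (a + b * τ) / (Complex.I * b) = (-Complex.I) * ((a / b : ℝ) + τ) := by
        rw [div_eq_iff (by simp [hb])]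
        push_cast
        field_simp
        linear_combination Complex.I_sq
      rw [this]
      simpa using hτ
    set w := (a + b * τ) / (Complex.I * b) with hwdef
    have hw0 : w ≠ 0 := fun h => by simp [h] at hw
    have hIbw : Complex.I * b * w = a + b * τ := by
      rw [hwdef]
      field_simp
    have hg := congrFun (fourier_gaussian_pi hw) (x / b)
    rw [Real.fourier_real_eq_integral_exp_smul] at hg
    have hfac : metaplecticFactor a b = (Complex.I * b) ^ (-(1/2) : ℂ) := by
      rw [metaplecticFactor, if_pos hb]
    rw [metaplectic_of_ne_zero a c d hb, hfac]
    have hint : ∫ y : ℝ, Complex.exp ((Real.pi : ℂ) * Complex.I / (b : ℂ) *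
          ((d * x ^ 2 - 2 * x * y + a * y ^ 2 : ℝ) : ℂ)) *
            Complex.exp (Real.pi * Complex.I * τ * y ^ 2) =
        Complex.exp (Real.pi * Complex.I * d / b * x ^ 2) *
          (1 / w ^ (1 / 2 : ℂ) * Complex.exp (-Real.pi / w * ((x / b : ℝ) : ℂ) ^ 2)) := by
      rw [← hg, ← integral_const_mul]
      congr 1
      funext y
      rw [smul_eq_mul, ← Complex.exp_add, ← Complex.exp_add, ← Complex.exp_add]
      congr 1
      rw [hwdef]
      push_cast
      field_simp
      linear_combination ((a + b * τ) * y ^ 2) * Complex.I_sq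
    rw [hint, ← hIbw, ← cpow_I_mul_mul hb hw, Complex.cpow_neg w, ← one_div (w ^ _), hIbw]
    have hexp : Complex.exp (Real.pi * Complex.I * ((c + d * τ) / (a + b * τ)) * x ^ 2) =
        Complex.exp (Real.pi * Complex.I * d / b * x ^ 2) *
          Complex.exp (-Real.pi / w * ((x / b : ℝ) : ℂ) ^ 2) := by
      rw [← Complex.exp_add]
      congr 1
      rw [hwdef]
      push_cast
      field_simp
      linear_combination (-(x ^ 2 * (a + b * τ)⁻¹ : ℂ)) * hC + d * x ^ 2 * mul_inv_cancel₀ hz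
    rw [hexp]
    ring

lemma metaplectic_const_mul (a b c d : ℝ) (k : ℂ) (f : ℝ → ℂ) (x : ℝ) :
    metaplectic a b c d (fun y => k * f y) x = k * metaplectic a b c d f x := by
  by_cases hb : b = 0
  · rw [metaplectic_of_eq_zero a c d hb, metaplectic_of_eq_zero a c d hb]
    ring
  · rw [metaplectic_of_ne_zero a c d hb, metaplectic_of_ne_zero a c d hb, mul_left_comm,
      ← integral_const_mul k]
    simp only [mul_left_comm]

/-- Composition of two metaplectic operators with nonzero upper right entries. -/
lemma metaplectic_comp_of_ne_zero (a1 c1 d1 a2 c2 d2 : ℝ) {b1 b2 : ℝ}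
    (hb1 : b1 ≠ 0) (hb2 : b2 ≠ 0) (f : ℝ → ℂ) (x : ℝ) :
    metaplectic a1 b1 c1 d1 (metaplectic a2 b2 c2 d2 f) x =
      metaplecticFactor a1 b1 * metaplecticFactor a2 b2 * |b2| * (chirp (d1 / b1) x *
        ∫ y : ℝ, 𝓕 (fun z => chirp (a2 / b2) z * f z) y *
          Complex.exp (Real.pi * Complex.I * ((a1 * b2 + b1 * d2) * b2 / b1 : ℝ) * y ^ 2
            - 2 * Real.pi * Complex.I * (b2 * x / b1 : ℝ) * y)) := by
  have hb1C : (b1 : ℂ) ≠ 0 := by exact_mod_cast hb1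
  have hb2C : (b2 : ℂ) ≠ 0 := by exact_mod_cast hb2
  have hscale := Measure.integral_comp_div (fun y : ℝ => 𝓕 (fun z => chirp (a2 / b2) z * f z) y *
    Complex.exp (Real.pi * Complex.I * ((a1 * b2 + b1 * d2) * b2 / b1 : ℝ) * y ^ 2
      - 2 * Real.pi * Complex.I * (b2 * x / b1 : ℝ) * y)) b2
  rw [Complex.real_smul] at hscale
  have hint : 𝓕 (fun y => chirp (a1 / b1) y * metaplectic a2 b2 c2 d2 f y) (x / b1) =
      metaplecticFactor a2 b2 * (|b2| * ∫ y : ℝ, 𝓕 (fun z => chirp (a2 / b2) z * f z) y *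
        Complex.exp (Real.pi * Complex.I * ((a1 * b2 + b1 * d2) * b2 / b1 : ℝ) * y ^ 2
          - 2 * Real.pi * Complex.I * (b2 * x / b1 : ℝ) * y)) := by
    rw [← hscale, ← integral_const_mul, Real.fourier_real_eq_integral_exp_smul]
    congr 1
    funext y
    have hexp : Complex.exp (Real.pi * Complex.I * ((a1 * b2 + b1 * d2) * b2 / b1 : ℝ) *
          ((y / b2 : ℝ) : ℂ) ^ 2 - 2 * Real.pi * Complex.I * (b2 * x / b1 : ℝ) * (y / b2 : ℝ)) =
        Complex.exp (↑(-2 * Real.pi * y * (x / b1)) * Complex.I) *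
          (chirp (a1 / b1) y * chirp (d2 / b2) y) := by
      rw [chirp, chirp, ← Complex.exp_add, ← Complex.exp_add]
      congr 1
      push_cast
      field_simp
      ring
    rw [hexp, metaplectic_eq_fourier a2 c2 d2 hb2, smul_eq_mul]
    ring
  rw [metaplectic_eq_fourier a1 c1 d1 hb1, hint]
  ring

/-- The composition of two metaplectic operators is a multiple of a metaplectic operator. -/
lemma exists_metaplectic_comp_eq {a1 b1 c1 d1 a2 b2 c2 d2 : ℝ}
    (h1 : a1 * d1 - b1 * c1 = 1) (h2 : a2 * d2 - b2 * c2 = 1) :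
    ∃ σ : ℂ, ∀ f : ℝ → ℂ, ChirpFourierIntegrable f → ∀ x : ℝ,
      metaplectic a1 b1 c1 d1 (metaplectic a2 b2 c2 d2 f) x
        = σ * metaplectic (a1 * a2 + b1 * c2) (a1 * b2 + b1 * d2)
            (c1 * a2 + d1 * c2) (c1 * b2 + d1 * d2) f x := by
  have h3 : (a1 * a2 + b1 * c2) * (c1 * b2 + d1 * d2) -
      (a1 * b2 + b1 * d2) * (c1 * a2 + d1 * c2) = 1 := by
    linear_combination (a2 * d2 - b2 * c2) * h1 + h2
  have hK3 := metaplecticFactor_ne_zero h3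
  have h1C : (a1 : ℂ) * d1 - b1 * c1 = 1 := by exact_mod_cast h1
  have h2C : (a2 : ℂ) * d2 - b2 * c2 = 1 := by exact_mod_cast h2
  suffices H : ∃ κ : ℂ, ∀ f : ℝ → ℂ, ChirpFourierIntegrable f → ∀ x : ℝ,
      κ * metaplectic (a1 * a2 + b1 * c2) (a1 * b2 + b1 * d2)
            (c1 * a2 + d1 * c2) (c1 * b2 + d1 * d2) f x =
        metaplecticFactor (a1 * a2 + b1 * c2) (a1 * b2 + b1 * d2) *
          metaplectic a1 b1 c1 d1 (metaplectic a2 b2 c2 d2 f) x by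
    obtain ⟨κ, hκ⟩ := H
    refine ⟨κ / metaplecticFactor (a1 * a2 + b1 * c2) (a1 * b2 + b1 * d2), fun f hf x => ?_⟩
    rw [div_mul_eq_mul_div, hκ f hf x, mul_div_cancel_left₀ _ hK3]
  set K3 := metaplecticFactor (a1 * a2 + b1 * c2) (a1 * b2 + b1 * d2) with hK3def
  by_cases hb1 : b1 = 0
  · have ha1 : a1 ≠ 0 := by rintro rfl; simp [hb1] at h1
    have ha1C : (a1 : ℂ) ≠ 0 := by exact_mod_cast ha1
    rw [hb1, Complex.ofReal_zero, zero_mul, sub_zero] at h1C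
    by_cases hb2 : b2 = 0
    · have ha2 : a2 ≠ 0 := by rintro rfl; simp [hb2] at h2
      have ha2C : (a2 : ℂ) ≠ 0 := by exact_mod_cast ha2
      rw [hb2, Complex.ofReal_zero, zero_mul, sub_zero] at h2C
      refine ⟨metaplecticFactor a1 b1 * metaplecticFactor a2 b2, fun f _ x => ?_⟩
      rw [metaplectic_of_eq_zero a1 c1 d1 hb1, metaplectic_of_eq_zero a2 c2 d2 hb2,
        metaplectic_of_eq_zero _ _ _ (show a1 * b2 + b1 * d2 = 0 by simp [hb1, hb2]), ← hK3def]
      have harg : x / (a1 * a2 + b1 * c2) = x / a1 / a2 := by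
        rw [hb1]
        field_simp
        ring
      have hexp : Complex.exp (Real.pi * Complex.I *
            (((c1 * a2 + d1 * c2) / (a1 * a2 + b1 * c2) : ℝ) : ℂ) * (x : ℂ) ^ 2) =
          Complex.exp (Real.pi * Complex.I * ((c1 / a1 : ℝ) : ℂ) * (x : ℂ) ^ 2) *
          Complex.exp (Real.pi * Complex.I * ((c2 / a2 : ℝ) : ℂ) * ((x / a1 : ℝ) : ℂ) ^ 2) := by
        rw [← Complex.exp_add, hb1]
        congr 1
        push_cast
        rw [zero_mul, add_zero]
        field_simp
        linear_combination (c2 * x ^ 2) * h1C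
      rw [harg, hexp]
      ring
    · have hb2C : (b2 : ℂ) ≠ 0 := by exact_mod_cast hb2
      have hb3 : a1 * b2 + b1 * d2 ≠ 0 := by simp [hb1, ha1, hb2]
      refine ⟨metaplecticFactor a1 b1 * metaplecticFactor a2 b2, fun f _ x => ?_⟩
      rw [metaplectic_of_eq_zero a1 c1 d1 hb1, metaplectic_of_ne_zero a2 c2 d2 hb2,
        metaplectic_of_ne_zero _ _ _ hb3, ← hK3def]
      have hint : ∫ y : ℝ, Complex.exp ((Real.pi : ℂ) * Complex.I / ((a1 * b2 + b1 * d2 : ℝ) : ℂ) *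
            (((c1 * b2 + d1 * d2) * x ^ 2 - 2 * x * y + (a1 * a2 + b1 * c2) * y ^ 2 : ℝ) : ℂ)) *
              f y =
          Complex.exp (Real.pi * Complex.I * ((c1 / a1 : ℝ) : ℂ) * (x : ℂ) ^ 2) *
            ∫ y : ℝ, Complex.exp ((Real.pi : ℂ) * Complex.I / (b2 : ℂ) *
              ((d2 * (x / a1) ^ 2 - 2 * (x / a1) * y + a2 * y ^ 2 : ℝ) : ℂ)) * f y := by
        rw [← integral_const_mul]
        congr 1
        funext y
        rw [← mul_assoc, ← Complex.exp_add, hb1]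
        congr 2
        push_cast
        rw [zero_mul, zero_mul, add_zero, add_zero]
        field_simp
        linear_combination (d2 * x ^ 2) * h1C
      rw [hint]
      ring
  · have hb1C : (b1 : ℂ) ≠ 0 := by exact_mod_cast hb1
    by_cases hb2 : b2 = 0
    · have ha2 : a2 ≠ 0 := by rintro rfl; simp [hb2] at h2
      have hd2 : d2 ≠ 0 := by rintro rfl; simp [hb2] at h2
      have ha2C : (a2 : ℂ) ≠ 0 := by exact_mod_cast ha2
      have hd2C : (d2 : ℂ) ≠ 0 := by exact_mod_cast hd2
      rw [hb2, Complex.ofReal_zero, zero_mul, sub_zero] at h2C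
      have hb3 : a1 * b2 + b1 * d2 ≠ 0 := by simp [hb2, hb1, hd2]
      refine ⟨metaplecticFactor a1 b1 * metaplecticFactor a2 b2 * |a2|, fun f _ x => ?_⟩
      rw [metaplectic_of_ne_zero a1 c1 d1 hb1, metaplectic_of_ne_zero _ _ _ hb3, ← hK3def]
      have hscale := Measure.integral_comp_div (fun y : ℝ =>
        Complex.exp ((Real.pi : ℂ) * Complex.I / ((a1 * b2 + b1 * d2 : ℝ) : ℂ) *
          (((c1 * b2 + d1 * d2) * x ^ 2 - 2 * x * y + (a1 * a2 + b1 * c2) * y ^ 2 : ℝ) : ℂ)) *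
            f y) a2
      rw [Complex.real_smul] at hscale
      have hint : ∫ y : ℝ, Complex.exp ((Real.pi : ℂ) * Complex.I / (b1 : ℂ) *
            ((d1 * x ^ 2 - 2 * x * y + a1 * y ^ 2 : ℝ) : ℂ)) * metaplectic a2 b2 c2 d2 f y =
          metaplecticFactor a2 b2 * (|a2| * ∫ y : ℝ,
            Complex.exp ((Real.pi : ℂ) * Complex.I / ((a1 * b2 + b1 * d2 : ℝ) : ℂ) *
              (((c1 * b2 + d1 * d2) * x ^ 2 - 2 * x * y + (a1 * a2 + b1 * c2) * y ^ 2 : ℝ) : ℂ)) *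
                f y) := by
        rw [← hscale, ← integral_const_mul]
        congr 1
        funext y
        have hexp : Complex.exp ((Real.pi : ℂ) * Complex.I / ((a1 * b2 + b1 * d2 : ℝ) : ℂ) *
              (((c1 * b2 + d1 * d2) * x ^ 2 - 2 * x * (y / a2) +
                (a1 * a2 + b1 * c2) * (y / a2) ^ 2 : ℝ) : ℂ)) =
            Complex.exp ((Real.pi : ℂ) * Complex.I / (b1 : ℂ) *
              ((d1 * x ^ 2 - 2 * x * y + a1 * y ^ 2 : ℝ) : ℂ)) *
            Complex.exp (Real.pi * Complex.I * ((c2 / a2 : ℝ) : ℂ) * (y : ℂ) ^ 2) := by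
          have hd2' : (d2 : ℂ) = (a2 : ℂ)⁻¹ :=
            eq_inv_of_mul_eq_one_right h2C
          rw [← Complex.exp_add, hb2]
          congr 1
          push_cast
          rw [mul_zero, mul_zero, zero_add, zero_add, hd2']
          field_simp
          ring
        rw [hexp, metaplectic_of_eq_zero a2 c2 d2 hb2]
        ring
      rw [hint]
      ring
    · have hb2C : (b2 : ℂ) ≠ 0 := by exact_mod_cast hb2
      have hint_chirp : ∀ f : ℝ → ℂ, ChirpFourierIntegrable f →
          Integrable (fun z => chirp (a2 / b2) z * f z) := fun f hf =>
        hf.integrable.bdd_mul (c := 1) (continuous_chirp _).aestronglyMeasurable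
          (Eventually.of_forall fun z => (norm_chirp _ z).le)
      by_cases hb3 : a1 * b2 + b1 * d2 = 0
      · have hb3C : (a1 : ℂ) * b2 + b1 * d2 = 0 := by exact_mod_cast hb3
        have ha3 : (a1 * a2 + b1 * c2) * b2 = -b1 := by
          linear_combination a2 * hb3 - b1 * h2
        have ha3' : a1 * a2 + b1 * c2 = -b1 / b2 := by rw [eq_div_iff hb2, ha3]
        refine ⟨metaplecticFactor a1 b1 * metaplecticFactor a2 b2 * |b2|, fun f hf x => ?_⟩
        rw [metaplectic_comp_of_ne_zero _ _ _ _ _ _ hb1 hb2, metaplectic_of_eq_zero _ _ _ hb3,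
          ← hK3def, hb3]
        set h : ℝ → ℂ := fun z => chirp (a2 / b2) z * f z with hdef
        have hinv : 𝓕⁻ (𝓕 h) = h := Continuous.fourierInv_fourier_eq
          ((continuous_chirp _).mul hf.continuous) (hint_chirp f hf) (hf.integrable_fourier _)
        have hint : ∫ y : ℝ, 𝓕 h y * Complex.exp (Real.pi * Complex.I * (0 * b2 / b1 : ℝ) * y ^ 2
            - 2 * Real.pi * Complex.I * (b2 * x / b1 : ℝ) * y) = h (-(b2 * x / b1)) := by
          rw [← congrFun hinv, Real.fourierInv_eq_fourier_neg, neg_neg,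
            Real.fourier_real_eq_integral_exp_smul]
          congr 1
          funext y
          rw [smul_eq_mul, mul_comm]
          congr 2
          push_cast
          ring
        have hx : x / (a1 * a2 + b1 * c2) = -(b2 * x / b1) := by
          rw [ha3']
          field_simp
        have hexp : Complex.exp (Real.pi * Complex.I *
              (((c1 * a2 + d1 * c2) / (a1 * a2 + b1 * c2) : ℝ) : ℂ) * (x : ℂ) ^ 2) =
            chirp (d1 / b1) x * chirp (a2 / b2) (-(b2 * x / b1)) := by
          rw [chirp, chirp, ← Complex.exp_add, ha3']
          congr 1
          push_cast
          field_simp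
          linear_combination (x ^ 2 * a2 * b2 : ℂ) * h1C + d1 * b1 * x ^ 2 * h2C -
            a2 * d1 * x ^ 2 * hb3C
        rw [hint, hdef, hx, hexp]
        ring
      · have hb3C : (a1 : ℂ) * b2 + b1 * d2 ≠ 0 := by exact_mod_cast hb3
        have hs : (a1 * b2 + b1 * d2) * b2 / b1 ≠ 0 := div_ne_zero (mul_ne_zero hb3 hb2) hb1
        refine ⟨metaplecticFactor a1 b1 * metaplecticFactor a2 b2 * |b2| *
          (1 / (-Complex.I * ((a1 * b2 + b1 * d2) * b2 / b1 : ℝ)) ^ (1 / 2 : ℂ)),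
          fun f hf x => ?_⟩
        rw [metaplectic_comp_of_ne_zero _ _ _ _ _ _ hb1 hb2, metaplectic_of_ne_zero _ _ _ hb3,
          ← hK3def, integral_fourier_mul_chirp (hint_chirp f hf) (hf.integrable_fourier _) hs]
        have hint : ∫ y : ℝ, Complex.exp ((Real.pi : ℂ) * Complex.I /
              ((a1 * b2 + b1 * d2 : ℝ) : ℂ) *
              (((c1 * b2 + d1 * d2) * x ^ 2 - 2 * x * y + (a1 * a2 + b1 * c2) * y ^ 2 : ℝ) : ℂ)) *
                f y =
            chirp (d1 / b1) x * ∫ t : ℝ, chirp (a2 / b2) t * f t *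
              Complex.exp (-(Real.pi * Complex.I / ((a1 * b2 + b1 * d2) * b2 / b1 : ℝ)) *
                (t + (b2 * x / b1 : ℝ)) ^ 2) := by
          rw [← integral_const_mul]
          congr 1
          funext y
          have hexp : Complex.exp ((Real.pi : ℂ) * Complex.I /
              ((a1 * b2 + b1 * d2 : ℝ) : ℂ) *
              (((c1 * b2 + d1 * d2) * x ^ 2 - 2 * x * y + (a1 * a2 + b1 * c2) * y ^ 2 : ℝ) : ℂ)) =
            chirp (d1 / b1) x * chirp (a2 / b2) y *
              Complex.exp (-(Real.pi * Complex.I / ((a1 * b2 + b1 * d2) * b2 / b1 : ℝ)) *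
                (y + (b2 * x / b1 : ℝ)) ^ 2) := by
            rw [chirp, chirp, ← Complex.exp_add, ← Complex.exp_add]
            congr 1
            push_cast
            field_simp
            linear_combination (-(x : ℂ) ^ 2 * b2 ^ 2) * h1C - (b1 * y) ^ 2 * h2C
          rw [hexp]
          ring
        rw [hint]
        ring

/-- Composition of metaplectic operators: `𝓜(M₁)𝓜(M₂) = σ 𝓜(M₁M₂)` with `σ = ±1`, and a
formula for `σ` in terms of principal square roots. -/
theorem stmt9 (a1 b1 c1 d1 a2 b2 c2 d2 : ℝ)
    (h1 : a1 * d1 - b1 * c1 = 1) (h2 : a2 * d2 - b2 * c2 = 1) :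
    ∃ σ : ℂ, (σ = 1 ∨ σ = -1) ∧
      (∀ f : SchwartzMap ℝ ℂ, ∀ x : ℝ,
        metaplectic a1 b1 c1 d1 (metaplectic a2 b2 c2 d2 (⇑f)) x
          = σ * metaplectic (a1 * a2 + b1 * c2) (a1 * b2 + b1 * d2)
              (c1 * a2 + d1 * c2) (c1 * b2 + d1 * d2) (⇑f) x) ∧
      (∀ τ : ℂ, 0 < τ.im →
        ¬(((a2 : ℂ) + (b2 : ℂ) * τ).im = 0 ∧ ((a2 : ℂ) + (b2 : ℂ) * τ).re ≤ 0) →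
        ¬((((a1 * a2 + b1 * c2 : ℝ) : ℂ) + ((a1 * b2 + b1 * d2 : ℝ) : ℂ) * τ).im = 0 ∧
          (((a1 * a2 + b1 * c2 : ℝ) : ℂ) + ((a1 * b2 + b1 * d2 : ℝ) : ℂ) * τ).re ≤ 0) →
        ¬(((((a1 * a2 + b1 * c2 : ℝ) : ℂ) + ((a1 * b2 + b1 * d2 : ℝ) : ℂ) * τ)
              / ((a2 : ℂ) + (b2 : ℂ) * τ)).im = 0 ∧
          ((((a1 * a2 + b1 * c2 : ℝ) : ℂ) + ((a1 * b2 + b1 * d2 : ℝ) : ℂ) * τ)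
              / ((a2 : ℂ) + (b2 : ℂ) * τ)).re ≤ 0) →
        σ = ((a2 : ℂ) + (b2 : ℂ) * τ) ^ (-(1/2) : ℂ)
          * ((((a1 * a2 + b1 * c2 : ℝ) : ℂ) + ((a1 * b2 + b1 * d2 : ℝ) : ℂ) * τ)
              / ((a2 : ℂ) + (b2 : ℂ) * τ)) ^ (-(1/2) : ℂ)
          * (((a1 * a2 + b1 * c2 : ℝ) : ℂ) + ((a1 * b2 + b1 * d2 : ℝ) : ℂ) * τ) ^ ((1/2) : ℂ)) := by
  obtain ⟨σ, hσ⟩ := exists_metaplectic_comp_eq h1 h2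
  have h3 : (a1 * a2 + b1 * c2) * (c1 * b2 + d1 * d2) -
      (a1 * b2 + b1 * d2) * (c1 * a2 + d1 * c2) = 1 := by
    linear_combination (a2 * d2 - b2 * c2) * h1 + h2
  have hformula : ∀ τ : ℂ, 0 < τ.im → σ = ((a2 : ℂ) + (b2 : ℂ) * τ) ^ (-(1/2) : ℂ)
      * ((((a1 * a2 + b1 * c2 : ℝ) : ℂ) + ((a1 * b2 + b1 * d2 : ℝ) : ℂ) * τ)
          / ((a2 : ℂ) + (b2 : ℂ) * τ)) ^ (-(1/2) : ℂ)
      * (((a1 * a2 + b1 * c2 : ℝ) : ℂ) + ((a1 * b2 + b1 * d2 : ℝ) : ℂ) * τ) ^ ((1/2) : ℂ) := by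
    intro τ hτ
    have hz2 := add_mul_ne_zero_of_im_pos h2 hτ
    have hz3 := add_mul_ne_zero_of_im_pos h3 hτ
    have hcomp := hσ _ (chirpFourierIntegrable_gaussian hτ) 0
    have hM2 := metaplectic_gaussian h2 hτ
    have hM1 := metaplectic_gaussian h1 (mobius_im_pos h2 hτ) 0
    have hlin : (a1 : ℂ) + b1 * ((c2 + d2 * τ) / (a2 + b2 * τ)) =
        (((a1 * a2 + b1 * c2 : ℝ) : ℂ) + ((a1 * b2 + b1 * d2 : ℝ) : ℂ) * τ) / (a2 + b2 * τ) := by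
      rw [eq_div_iff hz2, add_mul, mul_assoc, div_mul_cancel₀ _ hz2]
      push_cast
      ring
    rw [funext hM2, metaplectic_const_mul, hM1, metaplectic_gaussian h3 hτ, hlin] at hcomp
    simp only [Complex.ofReal_zero, ne_eq, OfNat.ofNat_ne_zero, not_false_eq_true, zero_pow,
      mul_zero, Complex.exp_zero, mul_one] at hcomp
    rw [hcomp, mul_assoc, ← Complex.cpow_add _ _ hz3]
    simp
  refine ⟨σ, ?_, fun f x => hσ f f.chirpFourierIntegrable x, fun τ hτ _ _ _ => hformula τ hτ⟩
  have hI : 0 < Complex.I.im := by simp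
  have hz2 := add_mul_ne_zero_of_im_pos h2 hI
  have hz3 := add_mul_ne_zero_of_im_pos h3 hI
  have hsq : ∀ z r : ℂ, z ≠ 0 → z ^ r * z ^ r = z ^ (r + r) := fun z r hz =>
    (Complex.cpow_add r r hz).symm
  have hmul : ∀ p q r : ℂ, p * q * r * (p * q * r) = p * p * (q * q) * (r * r) :=
    fun p q r => by ring
  have hinv : ∀ p q : ℂ, p ≠ 0 → q ≠ 0 → p⁻¹ * (q / p)⁻¹ * q = 1 := fun p q hp hq => by field_simp
  have hneg : (-(1/2) + -(1/2) : ℂ) = -1 := by ring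
  rw [← sq_eq_one_iff, sq, hformula Complex.I hI, hmul, hsq _ _ hz2,
    hsq _ _ (div_ne_zero hz3 hz2), hsq _ _ hz3, hneg, add_halves, Complex.cpow_neg_one,
    Complex.cpow_neg_one, Complex.cpow_one, hinv _ _ hz2 hz3]
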